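/- The double integral ∬_{[0,1]²} dx dy/√(x(1-x)y(1-y)(1-xy)) converges and equals (π/2)·Γ(1/4)²/Γ(3/4)², and it also equals π²·Σ_{n≥0} ((1/2)_n/n!)³. -/

import Mathlib

open MeasureTheory Real

/-- The rising Pochhammer symbol `(a)_n = a(a+1)⋯(a+n-1)`. -/
def poch (a : ℝ) (n : ℕ) : ℝ := ∏ i ∈ Finset.range n, (a + i)

open scoped ENNReal
open ProbabilityTheory (beta beta_pos)

lemma poch_succ (a : ℝ) (n : ℕ) : poch a (n + 1) = poch a n * (a + n) :=
  Finset.prod_range_succ _ _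

lemma poch_pos {a : ℝ} (ha : 0 < a) (n : ℕ) : 0 < poch a n :=
  Finset.prod_pos fun _ _ => by positivity

lemma poch_eq_eval_ascPochhammer (a : ℝ) (n : ℕ) : poch a n = (ascPochhammer ℝ n).eval a := by
  induction n with
  | zero => simp [poch]
  | succ n ih => rw [poch_succ, ih, ascPochhammer_succ_eval]

lemma Gamma_add_natCast {a : ℝ} (ha : 0 < a) (n : ℕ) : Gamma (a + n) = poch a n * Gamma a := by
  induction n with
  | zero => simp [poch]
  | succ n ih =>
    rw [Nat.cast_succ, ← add_assoc, Gamma_add_one (by positivity), ih, poch_succ]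
    ring

/-- The coefficient `(a)_n / n!` of the binomial series of `(1 - x)^(-a)`. -/
noncomputable def pochCoeff (a : ℝ) (n : ℕ) : ℝ := poch a n / n.factorial

lemma pochCoeff_pos {a : ℝ} (ha : 0 < a) (n : ℕ) : 0 < pochCoeff a n :=
  div_pos (poch_pos ha n) (by positivity)

lemma pochCoeff_zero (a : ℝ) : pochCoeff a 0 = 1 := by simp [pochCoeff, poch]

lemma succ_mul_pochCoeff_succ (a : ℝ) (n : ℕ) :
    ((n : ℝ) + 1) * pochCoeff a (n + 1) = (a + n) * pochCoeff a n := by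
  rw [pochCoeff, pochCoeff, poch_succ, Nat.factorial_succ, Nat.cast_mul, Nat.cast_succ]
  field_simp

lemma choose_eq_pochCoeff (a : ℝ) (n : ℕ) : Ring.choose (a + n - 1) n = pochCoeff a n := by
  have h := Ring.factorial_nsmul_multichoose_eq_ascPochhammer a n
  rw [← Ring.multichoose_eq, pochCoeff, eq_div_iff (by positivity), poch_eq_eval_ascPochhammer,
    ← Polynomial.ascPochhammer_smeval_eq_eval, Polynomial.ascPochhammer_smeval_cast, ← h,
    nsmul_eq_mul, mul_comm]

lemma hasSum_pochCoeff_mul_pow (a : ℝ) {x : ℝ} (hx : x ∈ Set.Ioo (0 : ℝ) 1) :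
    HasSum (fun n => pochCoeff a n * x ^ n) ((1 - x) ^ (-a)) := by
  have h := (Real.one_div_one_sub_rpow_hasFPowerSeriesOnBall_zero a).hasSum (y := x)
    (by simpa [enorm_eq_nnnorm, ← NNReal.coe_lt_coe, abs_of_pos hx.1] using hx.2)
  simpa [FormalMultilinearSeries.ofScalars_apply_eq, choose_eq_pochCoeff,
    mul_comm, rpow_neg (sub_nonneg.2 hx.2.le)] using h

lemma tsum_ofReal_pochCoeff_mul_pow {a : ℝ} (ha : 0 < a) {x : ℝ} (hx : x ∈ Set.Ioo (0 : ℝ) 1) :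
    ∑' n, ENNReal.ofReal (pochCoeff a n * x ^ n) = ENNReal.ofReal ((1 - x) ^ (-a)) := by
  have h := hasSum_pochCoeff_mul_pow a hx
  rw [← h.tsum_eq, ENNReal.ofReal_tsum_of_nonneg _ h.summable]
  exact fun n => mul_nonneg (pochCoeff_pos ha n).le (pow_nonneg hx.1.le n)

lemma setLIntegral_rpow_mul_one_sub_rpow {α β : ℝ} (hα : 0 < α) (hβ : 0 < β) :
    ∫⁻ x in Set.Ioo (0 : ℝ) 1, ENNReal.ofReal (x ^ (α - 1) * (1 - x) ^ (β - 1)) =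
      ENNReal.ofReal (beta α β) := by
  have h := ProbabilityTheory.lintegral_betaPDF_eq_one hα hβ
  have hb := beta_pos hα hβ
  simp_rw [ProbabilityTheory.lintegral_betaPDF, mul_assoc,
    ENNReal.ofReal_mul (one_div_pos.2 hb).le] at h
  rw [lintegral_const_mul _ (by fun_prop)] at h
  calc _ = ENNReal.ofReal (beta α β) * (ENNReal.ofReal (1 / beta α β) *
        ∫⁻ x in Set.Ioo (0 : ℝ) 1, ENNReal.ofReal (x ^ (α - 1) * (1 - x) ^ (β - 1))) := by
        rw [← mul_assoc, ← ENNReal.ofReal_mul hb.le, mul_one_div_cancel hb.ne',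
          ENNReal.ofReal_one, one_mul]
    _ = _ := by rw [h, mul_one]

lemma beta_add_natCast_one_sub {a : ℝ} (ha : 0 < a) (n : ℕ) :
    beta (a + n) (1 - a) = Gamma a * Gamma (1 - a) * pochCoeff a n := by
  rw [beta, Gamma_add_natCast ha, show a + n + (1 - a) = n + 1 by ring, Gamma_nat_eq_factorial,
    pochCoeff]
  ring

lemma setLIntegral_pow_mul_rpow_mul_one_sub_rpow {a : ℝ} (ha : 0 < a) (ha' : a < 1) (n : ℕ) :
    ∫⁻ x in Set.Ioo (0 : ℝ) 1, ENNReal.ofReal (x ^ n * (x ^ (a - 1) * (1 - x) ^ (-a))) =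
      ENNReal.ofReal (Gamma a * Gamma (1 - a) * pochCoeff a n) := by
  rw [← beta_add_natCast_one_sub ha, ← setLIntegral_rpow_mul_one_sub_rpow (by positivity)
    (sub_pos.2 ha')]
  refine setLIntegral_congr_fun measurableSet_Ioo fun x hx => ?_
  rw [← mul_assoc, ← rpow_natCast, ← rpow_add hx.1, show (n : ℝ) + (a - 1) = a + n - 1 by ring,
    show -a = 1 - a - 1 by ring]

lemma tsum_ofReal_pochCoeff_sq {a : ℝ} (ha : 0 < a) (ha' : a < 1 / 2) :
    ∑' n, ENNReal.ofReal (pochCoeff a n ^ 2) =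
      ENNReal.ofReal (Gamma (1 - 2 * a) / Gamma (1 - a) ^ 2) := by
  have hΓ : 0 < Gamma a * Gamma (1 - a) :=
    mul_pos (Gamma_pos_of_pos ha) (Gamma_pos_of_pos (by linarith))
  have key : ENNReal.ofReal (Gamma a * Gamma (1 - a)) * ∑' n, ENNReal.ofReal (pochCoeff a n ^ 2) =
      ENNReal.ofReal (beta a (1 - 2 * a)) := by
    rw [← ENNReal.tsum_mul_left, ← setLIntegral_rpow_mul_one_sub_rpow ha (by linarith)]
    calc _ = ∑' n, ∫⁻ x in Set.Ioo (0 : ℝ) 1, ENNReal.ofReal (pochCoeff a n) *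
          ENNReal.ofReal (x ^ n * (x ^ (a - 1) * (1 - x) ^ (-a))) := by
          refine tsum_congr fun n => ?_
          rw [lintegral_const_mul _ (by fun_prop),
            setLIntegral_pow_mul_rpow_mul_one_sub_rpow ha (by linarith),
            ← ENNReal.ofReal_mul hΓ.le, ← ENNReal.ofReal_mul (pochCoeff_pos ha n).le]
          ring_nf
      _ = ∫⁻ x in Set.Ioo (0 : ℝ) 1, ∑' n, ENNReal.ofReal (pochCoeff a n) *
          ENNReal.ofReal (x ^ n * (x ^ (a - 1) * (1 - x) ^ (-a))) :=
          (lintegral_tsum fun n => by fun_prop).symm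
      _ = _ := by
          refine setLIntegral_congr_fun measurableSet_Ioo fun x hx => ?_
          have hx' : 0 < 1 - x := sub_pos.2 hx.2
          have h0 : 0 ≤ x ^ (a - 1) * (1 - x) ^ (-a) :=
            mul_nonneg (rpow_nonneg hx.1.le _) (rpow_nonneg hx'.le _)
          have h1 (n : ℕ) : ENNReal.ofReal (pochCoeff a n) *
              ENNReal.ofReal (x ^ n * (x ^ (a - 1) * (1 - x) ^ (-a))) =
              ENNReal.ofReal (pochCoeff a n * x ^ n) *
                ENNReal.ofReal (x ^ (a - 1) * (1 - x) ^ (-a)) := by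
            rw [← ENNReal.ofReal_mul (pochCoeff_pos ha n).le, ← mul_assoc,
              ENNReal.ofReal_mul' h0]
          simp only [h1]
          rw [ENNReal.tsum_mul_right, tsum_ofReal_pochCoeff_mul_pow ha hx,
            ← ENNReal.ofReal_mul' h0, mul_left_comm, ← rpow_add hx',
            show -a + -a = 1 - 2 * a - 1 by ring]
  have h2 : beta a (1 - 2 * a) =
      Gamma a * Gamma (1 - a) * (Gamma (1 - 2 * a) / Gamma (1 - a) ^ 2) := by
    have := (Gamma_pos_of_pos (show 0 < 1 - a by linarith)).ne'
    rw [beta, show a + (1 - 2 * a) = 1 - a by ring]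
    field_simp
  rw [h2, ENNReal.ofReal_mul hΓ.le] at key
  exact (ENNReal.mul_right_inj (by simpa using hΓ) ENNReal.ofReal_ne_top).1 key

lemma hasSum_pochCoeff_sq {a : ℝ} (ha : 0 < a) (ha' : a < 1 / 2) :
    HasSum (fun n => pochCoeff a n ^ 2) (Gamma (1 - 2 * a) / Gamma (1 - a) ^ 2) := by
  have h := tsum_ofReal_pochCoeff_sq ha ha'
  have h0 : 0 ≤ Gamma (1 - 2 * a) / Gamma (1 - a) ^ 2 :=
    div_nonneg (Gamma_pos_of_pos (by linarith)).le (sq_nonneg _)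
  have hs : Summable fun n => pochCoeff a n ^ 2 := by
    have := ENNReal.summable_toReal (h.trans_ne ENNReal.ofReal_ne_top)
    simpa [ENNReal.toReal_ofReal, sq_nonneg] using this
  rw [← ENNReal.ofReal_tsum_of_nonneg (fun n => sq_nonneg _) hs,
    ENNReal.ofReal_eq_ofReal_iff (tsum_nonneg fun n => sq_nonneg _) h0] at h
  exact h ▸ hs.hasSum

/-- Coefficientwise form of Clausen's identity
`₂F₁(1/4, 1/4; 1; z)² = ₃F₂(1/2, 1/2, 1/2; 1, 1; z)`. -/
lemma sum_pochCoeff_quarter_sq (n : ℕ) :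
    ∑ k ∈ Finset.range (n + 1), pochCoeff (1 / 4) k ^ 2 * pochCoeff (1 / 4) (n - k) ^ 2 =
      pochCoeff (1 / 2) n ^ 3 := by
  induction n with
  | zero => simp [pochCoeff_zero]
  | succ n ih =>
    set c := pochCoeff (1 / 4)
    have hc (k : ℕ) : ((k : ℝ) + 1) * c (k + 1) = (1 / 4 + k) * c k := succ_mul_pochCoeff_succ _ _
    have hrec := succ_mul_pochCoeff_succ (1 / 2) n
    let G (k : ℕ) : ℝ := (2 * k - 3 * n - 3) * k ^ 2 * c k ^ 2 * c (n + 1 - k) ^ 2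
    have htel : ∀ k ∈ Finset.range (n + 1),
        ((n : ℝ) + 1) ^ 3 * (c k ^ 2 * c (n + 1 - k) ^ 2) -
          (1 / 2 + n : ℝ) ^ 3 * (c k ^ 2 * c (n - k) ^ 2) = G (k + 1) - G k := by
      intro k hk
      obtain ⟨m, rfl⟩ := Nat.exists_eq_add_of_le (Nat.lt_succ_iff.1 (Finset.mem_range.1 hk))
      simp only [G, show k + m + 1 - k = m + 1 by omega, show k + m + 1 - (k + 1) = m by omega,
        show k + m - k = m by omega]
      have hm : c (m + 1) = (1 / 4 + m) * c m / (m + 1) := by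
        rw [← hc]; field_simp
      have hk : c (k + 1) = (1 / 4 + k) * c k / (k + 1) := by
        rw [← hc]; field_simp
      rw [hm, hk]
      push_cast
      field_simp
      ring
    have hsum := Finset.sum_congr rfl htel
    rw [Finset.sum_range_sub, Finset.sum_sub_distrib, ← Finset.mul_sum, ← Finset.mul_sum, ih]
      at hsum
    have hG0 : G 0 = 0 := by simp [G]
    have hG1 : G (n + 1) = -((n : ℝ) + 1) ^ 3 * (c (n + 1) ^ 2 * c (n + 1 - (n + 1)) ^ 2) := by
      simp only [G]; push_cast; ring
    rw [Finset.sum_range_succ]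
    refine mul_left_cancel₀ (show ((n : ℝ) + 1) ^ 3 ≠ 0 by positivity) ?_
    rw [← mul_pow _ _ 3, hrec]
    linear_combination hsum + hG1 - hG0

lemma hasSum_pochCoeff_half_cube :
    HasSum (fun n => pochCoeff (1 / 2) n ^ 3) (π / Gamma (3 / 4) ^ 4) := by
  have h := hasSum_pochCoeff_sq (a := 1 / 4) (by norm_num) (by norm_num)
  have hn : Summable fun n => ‖pochCoeff (1 / 4) n ^ 2‖ := h.summable.norm
  have hp := (summable_norm_sum_mul_range_of_summable_norm hn hn).of_norm.hasSum
  rw [← tsum_mul_tsum_eq_tsum_sum_range_of_summable_norm hn hn, h.tsum_eq] at hp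
  simp_rw [sum_pochCoeff_quarter_sq] at hp
  rw [show (1 : ℝ) - 2 * (1 / 4) = 1 / 2 by norm_num, show (1 : ℝ) - 1 / 4 = 3 / 4 by norm_num,
    Gamma_one_half_eq, div_mul_div_comm, mul_self_sqrt pi_pos.le, ← pow_add] at hp
  exact hp

lemma one_div_sqrt_eq_rpow {x y : ℝ} (hx : x ∈ Set.Ioo (0 : ℝ) 1) (hy : y ∈ Set.Ioo (0 : ℝ) 1) :
    1 / √(x * (1 - x) * y * (1 - y) * (1 - x * y)) =
      x ^ (1 / 2 - 1 : ℝ) * (1 - x) ^ (-(1 / 2) : ℝ) *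
        (y ^ (1 / 2 - 1 : ℝ) * (1 - y) ^ (-(1 / 2) : ℝ)) * (1 - x * y) ^ (-(1 / 2) : ℝ) := by
  have hx' : 0 < 1 - x := sub_pos.2 hx.2
  have hy' : 0 < 1 - y := sub_pos.2 hy.2
  have hx0 := hx.1
  have hy0 := hy.1
  have hxy : 0 < 1 - x * y := by nlinarith
  rw [one_div, sqrt_eq_rpow, ← rpow_neg (by positivity), mul_rpow (by positivity) hxy.le,
    mul_rpow (by positivity) hy'.le, mul_rpow (by positivity) hy0.le, mul_rpow hx0.le hx'.le,
    show (1 / 2 - 1 : ℝ) = -(1 / 2) by norm_num]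
  ring

lemma setLIntegral_one_div_sqrt :
    ∫⁻ p in Set.Ioo (0 : ℝ) 1 ×ˢ Set.Ioo (0 : ℝ) 1, ENNReal.ofReal
        (1 / √(p.1 * (1 - p.1) * p.2 * (1 - p.2) * (1 - p.1 * p.2))) =
      ENNReal.ofReal (π ^ 2 * (π / Gamma (3 / 4) ^ 4)) := by
  let w (n : ℕ) (x : ℝ) : ℝ≥0∞ :=
    ENNReal.ofReal (x ^ n * (x ^ (1 / 2 - 1 : ℝ) * (1 - x) ^ (-(1 / 2) : ℝ)))
  have hw (n : ℕ) : Measurable (w n) := by fun_prop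
  have hwi (n : ℕ) : ∫⁻ x in Set.Ioo (0 : ℝ) 1, w n x =
      ENNReal.ofReal (π * pochCoeff (1 / 2) n) := by
    rw [setLIntegral_pow_mul_rpow_mul_one_sub_rpow (by norm_num) (by norm_num),
      show (1 : ℝ) - 1 / 2 = 1 / 2 by norm_num, Gamma_one_half_eq, mul_self_sqrt pi_pos.le]
  have hc (n : ℕ) : 0 < pochCoeff (1 / 2) n := pochCoeff_pos (by norm_num) n
  calc _ = ∫⁻ p in Set.Ioo (0 : ℝ) 1 ×ˢ Set.Ioo (0 : ℝ) 1,
        ∑' n, ENNReal.ofReal (pochCoeff (1 / 2) n) * (w n p.1 * w n p.2) := by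
        refine setLIntegral_congr_fun (measurableSet_Ioo.prod measurableSet_Ioo) ?_
        rintro ⟨x, y⟩ ⟨hx, hy⟩
        simp only at hx hy ⊢
        have hx0 := hx.1
        have hy0 := hy.1
        have hxy : x * y ∈ Set.Ioo (0 : ℝ) 1 := ⟨mul_pos hx0 hy0, by nlinarith [hx.2, hy.2]⟩
        have hnx : 0 ≤ x ^ (1 / 2 - 1 : ℝ) * (1 - x) ^ (-(1 / 2) : ℝ) :=
          mul_nonneg (rpow_nonneg hx0.le _) (rpow_nonneg (sub_pos.2 hx.2).le _)
        have hny : 0 ≤ y ^ (1 / 2 - 1 : ℝ) * (1 - y) ^ (-(1 / 2) : ℝ) :=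
          mul_nonneg (rpow_nonneg hy0.le _) (rpow_nonneg (sub_pos.2 hy.2).le _)
        rw [one_div_sqrt_eq_rpow hx hy, ENNReal.ofReal_mul (mul_nonneg hnx hny),
          ← tsum_ofReal_pochCoeff_mul_pow (by norm_num) hxy, ← ENNReal.tsum_mul_left]
        refine tsum_congr fun n => ?_
        rw [← ENNReal.ofReal_mul (mul_nonneg hnx hny), ← ENNReal.ofReal_mul (by positivity),
          ← ENNReal.ofReal_mul (hc n).le]
        congr 1
        ring
    _ = ∑' n, ∫⁻ p in Set.Ioo (0 : ℝ) 1 ×ˢ Set.Ioo (0 : ℝ) 1,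
        ENNReal.ofReal (pochCoeff (1 / 2) n) * (w n p.1 * w n p.2) :=
        lintegral_tsum fun n => by fun_prop
    _ = ∑' n, ENNReal.ofReal (π ^ 2 * pochCoeff (1 / 2) n ^ 3) := by
        refine tsum_congr fun n => ?_
        rw [lintegral_const_mul _ (by fun_prop), Measure.volume_eq_prod, ← Measure.prod_restrict,
          lintegral_prod_mul (hw n).aemeasurable (hw n).aemeasurable, hwi,
          ← ENNReal.ofReal_mul (mul_nonneg pi_pos.le (hc n).le), ← ENNReal.ofReal_mul (hc n).le]
        congr 1
        ring
    _ = _ := by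
        have h := hasSum_pochCoeff_half_cube.mul_left (π ^ 2)
        rw [← h.tsum_eq, ENNReal.ofReal_tsum_of_nonneg _ h.summable]
        exact fun n => mul_nonneg (sq_nonneg _) (pow_nonneg (hc n).le 3)

lemma Gamma_quarter_mul_Gamma_three_quarters : Gamma (1 / 4) * Gamma (3 / 4) = π * √2 := by
  have h := Gamma_mul_Gamma_one_sub (1 / 4)
  rw [show (1 : ℝ) - 1 / 4 = 3 / 4 by norm_num, mul_one_div, sin_pi_div_four] at h
  rw [h, div_div_eq_mul_div, div_eq_iff (by positivity), mul_assoc, mul_self_sqrt (by norm_num)]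

/-- `∬_{[0,1]²} dx dy/√(x(1-x)y(1-y)(1-xy))` converges, equals `(π/2)Γ(1/4)²/Γ(3/4)²`,
and also equals `π²·₃F₂(1/2,1/2,1/2;1,1;1)`. -/
theorem I₂_zero_eval :
    IntegrableOn
      (fun p : ℝ × ℝ => 1 / Real.sqrt (p.1 * (1 - p.1) * p.2 * (1 - p.2) * (1 - p.1 * p.2)))
      (Set.Ioo (0 : ℝ) 1 ×ˢ Set.Ioo (0 : ℝ) 1) ∧
    (∫ p in Set.Ioo (0 : ℝ) 1 ×ˢ Set.Ioo (0 : ℝ) 1,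
        1 / Real.sqrt (p.1 * (1 - p.1) * p.2 * (1 - p.2) * (1 - p.1 * p.2)))
      = π / 2 * (Real.Gamma (1 / 4) ^ 2 / Real.Gamma (3 / 4) ^ 2) ∧
    (∫ p in Set.Ioo (0 : ℝ) 1 ×ˢ Set.Ioo (0 : ℝ) 1,
        1 / Real.sqrt (p.1 * (1 - p.1) * p.2 * (1 - p.2) * (1 - p.1 * p.2)))
      = π ^ 2 * ∑' n : ℕ, (poch (1 / 2) n / (n.factorial : ℝ)) ^ 3 := by
  have hΓ : 0 < Gamma (3 / 4) := Gamma_pos_of_pos (by norm_num)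
  have hnn : 0 ≤ᵐ[volume.restrict (Set.Ioo (0 : ℝ) 1 ×ˢ Set.Ioo (0 : ℝ) 1)]
      fun p : ℝ × ℝ => 1 / √(p.1 * (1 - p.1) * p.2 * (1 - p.2) * (1 - p.1 * p.2)) :=
    ae_of_all _ fun p => by positivity
  have hm : Measurable fun p : ℝ × ℝ =>
      1 / √(p.1 * (1 - p.1) * p.2 * (1 - p.2) * (1 - p.1 * p.2)) := by fun_prop
  have hint : ∫ p in Set.Ioo (0 : ℝ) 1 ×ˢ Set.Ioo (0 : ℝ) 1,
      1 / √(p.1 * (1 - p.1) * p.2 * (1 - p.2) * (1 - p.1 * p.2)) =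
        π ^ 2 * (π / Gamma (3 / 4) ^ 4) := by
    rw [integral_eq_lintegral_of_nonneg_ae hnn hm.aestronglyMeasurable, setLIntegral_one_div_sqrt,
      ENNReal.toReal_ofReal (by positivity)]
  refine ⟨⟨hm.aestronglyMeasurable, ?_⟩, ?_, ?_⟩
  · rw [hasFiniteIntegral_iff_ofReal hnn, setLIntegral_one_div_sqrt]
    exact ENNReal.ofReal_lt_top
  · rw [hint, eq_div_of_mul_eq hΓ.ne' Gamma_quarter_mul_Gamma_three_quarters, div_pow, mul_pow,
      sq_sqrt (by norm_num)]
    field_simp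
  · rw [hint, ← hasSum_pochCoeff_half_cube.tsum_eq]
    rfl
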